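/- Let J be a set of prime numbers and let R = ℤ[J^{-1}], the localization of ℤ at the multiplicative set generated by the primes in J. Let A be a commutative ℕ-graded connected R-algebra which is a finitely generated free R-module in each degree. Suppose that A ⊗_R ℚ is a graded polynomial ℚ-algebra of type (d_1, …, d_r) with all d_i > 0, and that for every prime p ∉ J the graded ℤ_p-algebra A ⊗_R ℤ_p is a graded polynomial ℤ_p-algebra (on finitely many generators of positive degrees). Then A is a graded polynomial R-algebra of type (d_1, …, d_r). -/

import Mathlib

open TensorProduct

/-- `A` (with grading `𝒜`) is a graded polynomial `k`-algebra of type `d = (d 1, …, d r)`: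
there is a `k`-algebra isomorphism from the polynomial algebra `k[x_1, …, x_r]`, graded so
that `x_i` is homogeneous of degree `d i` (and the scalars in degree `0`), carrying the
homogeneous components onto the components `𝒜 n`. -/
def IsGradedPolynomialOfType (k A : Type) [CommRing k] [CommRing A] [Algebra k A]
    (𝒜 : ℕ → Submodule k A) {r : ℕ} (d : Fin r → ℕ) : Prop :=
  ∃ e : MvPolynomial (Fin r) k ≃ₐ[k] A,
    ∀ n : ℕ,
      (MvPolynomial.weightedHomogeneousSubmodule k d n).map e.toLinearMap = 𝒜 n

/-- The graded algebra `(A, 𝒜)` is connected: the structure map `k → A` is injective and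
its image is exactly the degree-zero component. -/
def GradedConnected (k A : Type) [CommRing k] [CommRing A] [Algebra k A]
    (𝒜 : ℕ → Submodule k A) : Prop :=
  Function.Injective (algebraMap k A) ∧ 𝒜 0 = LinearMap.range (Algebra.linearMap k A)

theorem IsNoetherianRing.injective_of_surjective_ringHom {P : Type*} [CommRing P]
    [IsNoetherianRing P] (f : P →+* P) (hf : Function.Surjective f) : Function.Injective f := by
  have hmono : Monotone fun n => RingHom.ker (f ^ n) := by
    refine monotone_nat_of_le_succ fun n x hx => ?_
    rw [RingHom.mem_ker, RingHom.coe_pow] at hx ⊢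
    rw [Function.iterate_succ_apply', hx, map_zero]
  obtain ⟨n, hn⟩ := monotone_stabilizes_iff_noetherian.2 ‹IsNoetherianRing P› ⟨_, hmono⟩
  rw [injective_iff_map_eq_zero]
  intro x hx
  obtain ⟨y, rfl⟩ := hf.iterate n x
  have hy : y ∈ RingHom.ker (f ^ (n + 1)) := by
    rw [RingHom.mem_ker, RingHom.coe_pow, Function.iterate_succ_apply', hx]
  have hker : RingHom.ker (f ^ n) = RingHom.ker (f ^ (n + 1)) := hn (n + 1) n.le_succ
  rw [← hker, RingHom.mem_ker, RingHom.coe_pow] at hy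
  exact hy

/-- The degree `n` products of two elements of positive degree, and their linear combinations. -/
def decomposables {k B : Type*} [CommRing k] [CommRing B] [Algebra k B]
    (𝓑 : ℕ → Submodule k B) (n : ℕ) : Submodule k B :=
  Submodule.span k {z | ∃ i j, 0 < i ∧ 0 < j ∧ i + j = n ∧ ∃ x ∈ 𝓑 i, ∃ y ∈ 𝓑 j, x * y = z}

theorem mul_mem_decomposables {k B : Type*} [CommRing k] [CommRing B] [Algebra k B]
    {𝓑 : ℕ → Submodule k B} {i j : ℕ} (hi : 0 < i) (hj : 0 < j) {x y : B}
    (hx : x ∈ 𝓑 i) (hy : y ∈ 𝓑 j) : x * y ∈ decomposables 𝓑 (i + j) :=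
  Submodule.subset_span ⟨i, j, hi, hj, rfl, x, hx, y, hy, rfl⟩

theorem decomposables_le {k B : Type*} [CommRing k] [CommRing B] [Algebra k B]
    {𝓑 : ℕ → Submodule k B} {n : ℕ} {N : Submodule k B}
    (h : ∀ i j, 0 < i → 0 < j → i + j = n → ∀ x ∈ 𝓑 i, ∀ y ∈ 𝓑 j, x * y ∈ N) :
    decomposables 𝓑 n ≤ N := by
  refine Submodule.span_le.2 ?_
  rintro _ ⟨i, j, hi, hj, hij, x, hx, y, hy, rfl⟩
  exact h i j hi hj hij x hx y hy

theorem decomposables_baseChange {k B : Type*} [CommRing k] [CommRing B] [Algebra k B]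
    (K : Type*) [CommRing K] [Algebra k K] (𝓑 : ℕ → Submodule k B) (n : ℕ) :
    (decomposables 𝓑 n).baseChange K = decomposables (fun m => (𝓑 m).baseChange K) n := by
  apply le_antisymm
  · rw [decomposables, Submodule.baseChange_span, Submodule.span_le]
    rintro _ ⟨_, ⟨i, j, hi, hj, rfl, x, hx, y, hy, rfl⟩, rfl⟩
    have : (1 : K) ⊗ₜ[k] (x * y) = ((1 : K) ⊗ₜ[k] x) * ((1 : K) ⊗ₜ[k] y) := by simp
    rw [SetLike.mem_coe, TensorProduct.mk_apply, this]
    exact mul_mem_decomposables hi hj (Submodule.tmul_mem_baseChange_of_mem _ hx)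
      (Submodule.tmul_mem_baseChange_of_mem _ hy)
  · refine decomposables_le ?_
    rintro i j hi hj rfl x hx y hy
    simp only [Submodule.baseChange_eq_span] at hx hy
    induction hx, hy using Submodule.span_induction₂ with
    | mem_mem x y hx hy =>
      obtain ⟨x, hx, rfl⟩ := hx
      obtain ⟨y, hy, rfl⟩ := hy
      simp only [TensorProduct.mk_apply, Algebra.TensorProduct.tmul_mul_tmul, mul_one]
      exact Submodule.tmul_mem_baseChange_of_mem _ (mul_mem_decomposables hi hj hx hy)
    | zero_left y hy => simp
    | zero_right x hx => simp
    | add_left x y z _ _ _ h₁ h₂ => rw [add_mul]; exact add_mem h₁ h₂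
    | add_right x y z _ _ _ h₁ h₂ => rw [mul_add]; exact add_mem h₁ h₂
    | smul_left r x y _ _ h => rw [smul_mul_assoc]; exact Submodule.smul_mem _ _ h
    | smul_right r x y _ _ h => rw [mul_smul_comm]; exact Submodule.smul_mem _ _ h

theorem MvPolynomial.coeff_single_one_mul {σ k : Type*} [CommRing k] (i : σ)
    (u v : MvPolynomial σ k) :
    coeff (Finsupp.single i 1) (u * v) =
      coeff 0 u * coeff (Finsupp.single i 1) v + coeff (Finsupp.single i 1) u * coeff 0 v := by
  classical
  rw [coeff_mul, Finsupp.antidiagonal_single, Finset.sum_map]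
  simp [Finset.Nat.antidiagonal_succ]

/-- In a graded polynomial algebra, the decomposable elements of degree `n > 0` are those without
linear terms. -/
theorem mem_decomposables_iff_coeff {k B : Type*} [CommRing k] [CommRing B] [Algebra k B]
    {𝓑 : ℕ → Submodule k B} {r : ℕ} {d : Fin r → ℕ} (hd : ∀ i, 0 < d i)
    (e : MvPolynomial (Fin r) k ≃ₐ[k] B)
    (he : ∀ n, (MvPolynomial.weightedHomogeneousSubmodule k d n).map e.toLinearMap = 𝓑 n)
    {n : ℕ} (hn : 0 < n) {z : B} (hz : z ∈ 𝓑 n) :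
    z ∈ decomposables 𝓑 n ↔ ∀ i, MvPolynomial.coeff (Finsupp.single i 1) (e.symm z) = 0 := by
  constructor
  · intro h i
    let f : B →ₗ[k] k := MvPolynomial.lcoeff k (Finsupp.single i 1) ∘ₗ e.symm.toLinearMap
    suffices decomposables 𝓑 n ≤ LinearMap.ker f from this h
    refine decomposables_le ?_
    rintro a b ha hb - x hx y hy
    rw [← he] at hx hy
    obtain ⟨u, hu, rfl⟩ := hx
    obtain ⟨v, hv, rfl⟩ := hy
    have hu0 : MvPolynomial.coeff 0 u = 0 :=
      MvPolynomial.IsWeightedHomogeneous.coeff_eq_zero hu 0 (by simpa using ha.ne)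
    have hv0 : MvPolynomial.coeff 0 v = 0 :=
      MvPolynomial.IsWeightedHomogeneous.coeff_eq_zero hv 0 (by simpa using hb.ne)
    simp [f, MvPolynomial.coeff_single_one_mul, hu0, hv0]
  · intro h
    rw [← he] at hz
    obtain ⟨q, hq, rfl⟩ := hz
    simp only [AlgEquiv.toLinearMap_apply, AlgEquiv.symm_apply_apply] at h ⊢
    rw [MvPolynomial.as_sum q, map_sum]
    refine Submodule.sum_mem _ fun m hm => ?_
    have hc := MvPolynomial.mem_support_iff.1 hm
    have hw : Finsupp.weight d m = n := hq hc
    have hm0 : m ≠ 0 := by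
      rintro rfl
      simp at hw
      omega
    obtain ⟨i, hi⟩ := Finsupp.ne_iff.1 hm0
    have hle : Finsupp.single i 1 ≤ m := by
      rw [Finsupp.single_le_iff]
      exact Nat.one_le_iff_ne_zero.2 hi
    obtain ⟨m', rfl⟩ := exists_add_of_le hle
    have hm' : m' ≠ 0 := by
      rintro rfl
      exact hc (by simpa using h i)
    have hpos : 0 < Finsupp.weight d m' := by
      obtain ⟨j, hj⟩ := Finsupp.ne_iff.1 hm'
      exact (hd j).trans_le (Finsupp.le_weight_of_ne_zero' d hj)
    rw [map_add, Finsupp.weight_single, one_smul] at hw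
    rw [← hw, ← one_mul (MvPolynomial.coeff _ q), ← MvPolynomial.monomial_mul, map_mul]
    refine mul_mem_decomposables (hd i) hpos ?_ ?_
    · rw [← he]
      exact ⟨_, MvPolynomial.isWeightedHomogeneous_X k d i, rfl⟩
    · rw [← he]
      exact ⟨_, MvPolynomial.isWeightedHomogeneous_monomial d m' _ rfl, rfl⟩

theorem one_tmul_mkQ_eq_zero {R B M : Type*} [CommRing R] [CommRing B] [Algebra R B]
    [AddCommGroup M] [Module R M] {N : Submodule R M} {x : M}
    (hx : (1 : B) ⊗ₜ[R] x ∈ N.baseChange B) : (1 : B) ⊗ₜ[R] N.mkQ x = 0 := by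
  have : N.baseChange B ≤ LinearMap.ker (N.mkQ.baseChange B) := by
    rw [Submodule.baseChange_eq_span, Submodule.span_le]
    rintro _ ⟨y, hy, rfl⟩
    have : N.mkQ y = 0 := by simpa using hy
    simp [this, -Submodule.mkQ_apply]
  simpa using this hx

theorem exists_smul_mem_of_one_tmul_mem_baseChange {R K M : Type*} [CommRing R] [IsDomain R]
    [Field K] [Algebra R K] [IsFractionRing R K] [AddCommGroup M] [Module R M]
    {N : Submodule R M} {x : M} (hx : (1 : K) ⊗ₜ[R] x ∈ N.baseChange K) :
    ∃ c : R, c ≠ 0 ∧ c • x ∈ N := by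
  have h := one_tmul_mkQ_eq_zero hx
  obtain ⟨c, hc⟩ := (IsLocalizedModule.eq_zero_iff (nonZeroDivisors R)
    (TensorProduct.mk R K (M ⧸ N) 1) (m := N.mkQ x)).1 h
  refine ⟨c, nonZeroDivisors.coe_ne_zero c, ?_⟩
  rw [← Submodule.Quotient.mk_eq_zero N]
  exact hc

/-- If `x` lies in `N` after base change to a flat local algebra `B`, then `x` is carried into `N`
by a scalar that becomes a unit in `B`. -/
theorem exists_isUnit_smul_mem_of_one_tmul_mem_baseChange {R B M : Type*} [CommRing R]
    [CommRing B] [IsLocalRing B] [Algebra R B] [Module.Flat R B] [AddCommGroup M] [Module R M]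
    {N : Submodule R M} {x : M} (hx : (1 : B) ⊗ₜ[R] x ∈ N.baseChange B) :
    ∃ c : R, IsUnit (algebraMap R B c) ∧ c • x ∈ N := by
  have h := one_tmul_mkQ_eq_zero hx
  set y := N.mkQ x with hy
  by_contra! hcon
  let I := Ideal.torsionOf R (M ⧸ N) y
  have hI : ∀ c ∈ I, algebraMap R B c ∈ IsLocalRing.maximalIdeal B := by
    intro c hc hu
    refine hcon c hu ?_
    rw [← Submodule.Quotient.mk_eq_zero N]
    exact hc
  let g : (R ⧸ I) →ₗ[R] M ⧸ N := I.liftQ (LinearMap.toSpanSingleton R _ y) le_rfl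
  have hg : Function.Injective g := by
    rw [← LinearMap.ker_eq_bot]
    exact Submodule.ker_liftQ_eq_bot _ _ _ le_rfl
  have hg' := Module.Flat.lTensor_preserves_injective_linearMap (M := B) g hg
  have h1 : (1 : B) ⊗ₜ[R] (I.mkQ 1) = 0 := by
    apply hg'
    have hg1 : g (I.mkQ 1) = y := one_smul R y
    rw [LinearMap.lTensor_tmul, map_zero, hg1, h]
  let k : (R ⧸ I) →ₗ[R] B ⧸ IsLocalRing.maximalIdeal B :=
    I.liftQ (Algebra.linearMap R _) (fun c hc => by
      rw [LinearMap.mem_ker, Algebra.linearMap_apply, IsScalarTower.algebraMap_apply R B]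
      exact Ideal.Quotient.eq_zero_iff_mem.2 (hI c hc))
  have h2 := congrArg (TensorProduct.AlgebraTensorModule.lift
    (LinearMap.toSpanSingleton B _ k)) h1
  have hk : k (I.mkQ 1) = 1 := map_one (algebraMap R (B ⧸ IsLocalRing.maximalIdeal B))
  rw [TensorProduct.AlgebraTensorModule.lift_tmul, map_zero, LinearMap.toSpanSingleton_apply,
    one_smul, hk] at h2
  exact one_ne_zero h2

/-- Generators of the indecomposables in degree `n`, one for each variable of degree `n`. -/
theorem exists_generators {R K A : Type} [CommRing R] [IsDomain R] [IsPrincipalIdealRing R]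
    [Field K] [Algebra R K] [IsFractionRing R K] [CommRing A] [Algebra R A]
    (𝒜 : ℕ → Submodule R A) {r : ℕ} (d : Fin r → ℕ) (hd : ∀ i, 0 < d i)
    (hK : IsGradedPolynomialOfType K (K ⊗[R] A) (fun n => (𝒜 n).baseChange K) d)
    {n : ℕ} (hn : 0 < n) [Module.Finite R (𝒜 n)]
    (hsat : ∀ a ∈ 𝒜 n, ∀ c : R, c ≠ 0 → c • a ∈ decomposables 𝒜 n → a ∈ decomposables 𝒜 n) :
    ∃ a : {i // d i = n} → A, (∀ i, a i ∈ 𝒜 n) ∧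
      ∀ x ∈ 𝒜 n, ∃ c : {i // d i = n} → R, x - ∑ i, c i • a i ∈ decomposables 𝒜 n := by
  obtain ⟨e, he⟩ := hK
  let Φ : K ⊗[R] A →ₗ[K] ({i // d i = n} → K) :=
    LinearMap.pi fun i => MvPolynomial.lcoeff K (Finsupp.single i.1 1) ∘ₗ e.symm.toLinearMap
  let φ : A →ₗ[R] ({i // d i = n} → K) := Φ.restrictScalars R ∘ₗ TensorProduct.mk R K A 1
  let L := (𝒜 n).map φ
  have hφ : ∀ x ∈ 𝒜 n, φ x = 0 → x ∈ decomposables 𝒜 n := by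
    intro x hx h0
    have hx' : (1 : K) ⊗ₜ[R] x ∈ (𝒜 n).baseChange K := Submodule.tmul_mem_baseChange_of_mem _ hx
    have hmem : (1 : K) ⊗ₜ[R] x ∈ (decomposables 𝒜 n).baseChange K := by
      rw [decomposables_baseChange]
      refine (mem_decomposables_iff_coeff hd e he hn hx').2 fun i => ?_
      by_cases hi : d i = n
      · exact congrFun h0 ⟨i, hi⟩
      · rw [← show _ = (𝒜 n).baseChange K from he n] at hx'
        obtain ⟨q, hq, hqx⟩ := hx'
        rw [← hqx]
        simpa using MvPolynomial.IsWeightedHomogeneous.coeff_eq_zero hq (Finsupp.single i 1)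
          (by simpa [Finsupp.weight_single] using hi)
    obtain ⟨c, hc, hcx⟩ := exists_smul_mem_of_one_tmul_mem_baseChange hmem
    exact hsat x hx c hc hcx
  have hL : Submodule.IsLattice K L := by
    refine ⟨(Module.Finite.iff_fg.1 inferInstance).map φ, ?_⟩
    have h1 : Submodule.span K (L : Set ({i // d i = n} → K)) = ((𝒜 n).baseChange K).map Φ := by
      rw [Submodule.baseChange_eq_span, Submodule.map_span]
      congr 1
      ext; simp [L, φ]
    rw [h1, eq_top_iff, ← (Pi.basisFun K {i // d i = n}).span_eq, Submodule.span_le]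
    rintro _ ⟨i, rfl⟩
    refine ⟨e (MvPolynomial.X i.1), ?_, ?_⟩
    · rw [← show _ = (𝒜 n).baseChange K from he n]
      refine ⟨_, ?_, rfl⟩
      have := MvPolynomial.isWeightedHomogeneous_X K d i.1
      rwa [i.2] at this
    · ext j
      simp [Φ, MvPolynomial.coeff_X, Pi.single_apply, Finsupp.single_left_inj, Subtype.ext_iff,
        eq_comm]
  have : Module.IsTorsionFree R K := inferInstance
  have : Module.Free R L := Submodule.IsLattice.free K L
  have : Module.Finite R L := Submodule.IsLattice.finite K L
  let b := (Module.finBasisOfFinrankEq R L (Submodule.IsLattice.finrank_of_pi (K := K) L)).reindex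
    (Fintype.equivFin {i // d i = n}).symm
  choose a ha hab using fun i => (b i).2
  refine ⟨a, ha, fun x hx => ?_⟩
  have hxL : φ x ∈ L := Submodule.mem_map_of_mem hx
  refine ⟨b.repr ⟨φ x, hxL⟩, hφ _ ?_ ?_⟩
  · exact sub_mem hx (Submodule.sum_mem _ fun i _ => Submodule.smul_mem _ _ (ha i))
  · have := congrArg L.subtype (b.sum_repr ⟨φ x, hxL⟩)
    rw [map_sum] at this
    rw [map_sub, map_sum, sub_eq_zero]
    simp only [map_smul, hab]
    exact this.symm

theorem IsGradedPolynomialOfType.of_saturated {R K A : Type} [CommRing R] [IsDomain R]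
    [IsPrincipalIdealRing R] [Field K] [Algebra R K] [IsFractionRing R K] [CommRing A]
    [Algebra R A] (𝒜 : ℕ → Submodule R A) [GradedAlgebra 𝒜]
    (h0 : 𝒜 0 ≤ LinearMap.range (Algebra.linearMap R A)) [∀ n, Module.Finite R (𝒜 n)]
    {r : ℕ} (d : Fin r → ℕ) (hd : ∀ i, 0 < d i)
    (hK : IsGradedPolynomialOfType K (K ⊗[R] A) (fun n => (𝒜 n).baseChange K) d)
    (hsat : ∀ n, 0 < n → ∀ a ∈ 𝒜 n, ∀ c : R, c ≠ 0 → c • a ∈ decomposables 𝒜 n →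
      a ∈ decomposables 𝒜 n) :
    IsGradedPolynomialOfType R A 𝒜 d := by
  have hgen := fun n (hn : 0 < n) => exists_generators 𝒜 d hd hK hn (hsat n hn)
  choose g hg hspan using hgen
  let a : Fin r → A := fun i => g (d i) (hd i) ⟨i, rfl⟩
  have hga : ∀ n (hn : 0 < n) (i : {i // d i = n}), g n hn i = a i := by
    rintro _ hn ⟨i, rfl⟩
    rfl
  have ha : ∀ i, a i ∈ 𝒜 (d i) := fun i => hg _ _ _
  let f : MvPolynomial (Fin r) R →ₐ[R] A := MvPolynomial.aeval a
  let W := MvPolynomial.weightedHomogeneousSubmodule R d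
  have hle : ∀ n, (W n).map f.toLinearMap ≤ 𝒜 n := by
    rintro n _ ⟨q, hq, rfl⟩
    rw [AlgHom.toLinearMap_apply, MvPolynomial.as_sum q, map_sum]
    refine Submodule.sum_mem _ fun m hm => ?_
    have hw : Finsupp.weight d m = n := hq (MvPolynomial.mem_support_iff.1 hm)
    rw [MvPolynomial.aeval_monomial, ← Algebra.smul_def, ← hw, Finsupp.weight_apply]
    exact Submodule.smul_mem _ _
      (SetLike.prod_pow_mem_graded 𝒜 d a m fun i _ => ha i)
  have hge : ∀ n, 𝒜 n ≤ (W n).map f.toLinearMap := by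
    intro n
    induction n using Nat.strong_induction_on with
    | _ n ih =>
    rcases Nat.eq_zero_or_pos n with rfl | hn
    · intro x hx
      obtain ⟨c, rfl⟩ := h0 hx
      exact ⟨MvPolynomial.C c, MvPolynomial.isWeightedHomogeneous_C d c, by simp [f]⟩
    · intro x hx
      obtain ⟨c, hc⟩ := hspan n hn x hx
      have hdec : decomposables 𝒜 n ≤ (W n).map f.toLinearMap := by
        refine decomposables_le ?_
        rintro i j hi hj rfl x hx y hy
        obtain ⟨p, hp, rfl⟩ := ih i (by omega) hx
        obtain ⟨q, hq, rfl⟩ := ih j (by omega) hy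
        exact ⟨p * q, MvPolynomial.IsWeightedHomogeneous.mul hp hq, by simp⟩
      rw [← sub_add_cancel x (∑ i, c i • g n hn i)]
      refine add_mem (hdec hc) (Submodule.sum_mem _ fun i _ => Submodule.smul_mem _ _ ?_)
      rw [hga]
      refine ⟨MvPolynomial.X i.1, ?_, by simp [f]⟩
      have := MvPolynomial.isWeightedHomogeneous_X R d i.1
      rwa [i.2] at this
  have hsurj : Function.Surjective f := by
    have : (⊤ : Submodule R A) ≤ LinearMap.range f.toLinearMap := by
      rw [← (DirectSum.Decomposition.isInternal 𝒜).submodule_iSup_eq_top]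
      exact iSup_le fun n => (hge n).trans LinearMap.map_le_range
    exact fun x => this (Submodule.mem_top (x := x))
  have hinj : Function.Injective f := by
    obtain ⟨e, -⟩ := hK
    let F : MvPolynomial (Fin r) K →ₐ[K] K ⊗[R] A :=
      MvPolynomial.aeval fun i => (1 : K) ⊗ₜ[R] a i
    have hF : ∀ q, F (MvPolynomial.map (algebraMap R K) q) = (1 : K) ⊗ₜ[R] f q := by
      intro q
      have : ((F.restrictScalars R).comp (MvPolynomial.mapAlgHom (Algebra.ofId R K))) =
          (Algebra.TensorProduct.includeRight : A →ₐ[R] K ⊗[R] A).comp f := by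
        ext i
        simp [F, f]
      exact DFunLike.congr_fun this q
    have hFsurj : Function.Surjective F := by
      intro z
      induction z using TensorProduct.induction_on with
      | zero => exact ⟨0, map_zero _⟩
      | add x y hx hy =>
        obtain ⟨p, rfl⟩ := hx
        obtain ⟨q, rfl⟩ := hy
        exact ⟨p + q, map_add ..⟩
      | tmul c x =>
        obtain ⟨q, rfl⟩ := hsurj x
        refine ⟨c • MvPolynomial.map (algebraMap R K) q, ?_⟩
        rw [map_smul, hF, TensorProduct.smul_tmul', smul_eq_mul, mul_one]
    have hFinj : Function.Injective F := by
      have := IsNoetherianRing.injective_of_surjective_ringHom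
        ((e.symm : K ⊗[R] A →+* MvPolynomial (Fin r) K).comp (F : _ →+* K ⊗[R] A))
        (e.symm.surjective.comp hFsurj)
      exact Function.Injective.of_comp (f := e.symm) this
    rw [injective_iff_map_eq_zero]
    intro q hq
    have h := hF q
    rw [hq, TensorProduct.tmul_zero] at h
    exact MvPolynomial.map_injective _ (IsFractionRing.injective R K)
      (by rw [hFinj (h.trans (map_zero F).symm), map_zero])
  exact ⟨AlgEquiv.ofBijective f ⟨hinj, hsurj⟩, fun n => le_antisymm (hle n) (hge n)⟩

theorem IsGradedPolynomialOfType.mem_decomposables_of_smul_mem {k B : Type} [CommRing k]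
    [IsDomain k] [CommRing B] [Algebra k B] {𝓑 : ℕ → Submodule k B} {r : ℕ} {d : Fin r → ℕ}
    (hd : ∀ i, 0 < d i) (h : IsGradedPolynomialOfType k B 𝓑 d) {n : ℕ} (hn : 0 < n) {z : B}
    (hz : z ∈ 𝓑 n) {c : k} (hc : c ≠ 0) (hcz : c • z ∈ decomposables 𝓑 n) :
    z ∈ decomposables 𝓑 n := by
  obtain ⟨e, he⟩ := h
  rw [mem_decomposables_iff_coeff hd e he hn hz]
  rw [mem_decomposables_iff_coeff hd e he hn (Submodule.smul_mem _ _ hz)] at hcz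
  exact fun i => (mul_eq_zero.1 (by simpa using hcz i)).resolve_left hc

theorem IsLocalization.isPrincipalIdealRing {R : Type*} (R' : Type*) [CommRing R] [CommRing R']
    [Algebra R R'] (S : Submonoid R) [IsLocalization S R'] [IsPrincipalIdealRing R] :
    IsPrincipalIdealRing R' where
  principal I := by
    rw [← IsLocalization.map_under S R' I]
    obtain ⟨x, hx⟩ := IsPrincipalIdealRing.principal (I.under R)
    rw [hx]
    exact ⟨algebraMap R R' x, by simp [Ideal.submodule_span_eq, Ideal.map_span]⟩

theorem PadicInt.isUnit_intCast_iff {p : ℕ} [Fact p.Prime] {m : ℤ} :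
    IsUnit (m : ℤ_[p]) ↔ ¬ (p : ℤ) ∣ m := by
  rw [← PadicInt.norm_int_lt_one_iff_dvd, ← PadicInt.not_isUnit_iff, not_not]

/-- Let `J` be a set of primes, `R = ℤ[J⁻¹]`, and `A` a commutative `ℕ`-graded
connected `R`-algebra which is a finitely generated free `R`-module in each degree.  If
`A ⊗_R ℚ` is a graded polynomial `ℚ`-algebra of type `(d 1, …, d r)` with all degrees
positive, and `A ⊗_R ℤ_p` is a graded polynomial `ℤ_p`-algebra on finitely many generators
of positive degrees for every prime `p ∉ J`, then `A` is a graded polynomial `R`-algebra of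
type `(d 1, …, d r)`.  (The `R`-algebra structures on `ℚ` and on `ℤ_p` are unique, so the
instance quantifications below single out the canonical maps.) -/
theorem steenrod_stmt_5 (J : Set ℕ) (hJ : ∀ p ∈ J, Nat.Prime p)
    (S : Submonoid ℤ) (hS : S = Submonoid.closure ((fun p : ℕ => (p : ℤ)) '' J))
    (A : Type) [CommRing A] [Algebra (Localization S) A]
    (𝒜 : ℕ → Submodule (Localization S) A) [GradedAlgebra 𝒜]
    (hconn : GradedConnected (Localization S) A 𝒜)
    (hfree : ∀ n : ℕ, Module.Free (Localization S) (𝒜 n) ∧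
      Module.Finite (Localization S) (𝒜 n))
    {r : ℕ} (d : Fin r → ℕ) (hd : ∀ i, 0 < d i)
    (hQ : ∀ [Algebra (Localization S) ℚ],
      IsGradedPolynomialOfType ℚ (ℚ ⊗[Localization S] A)
        (fun n => (𝒜 n).baseChange ℚ) d)
    (hZp : ∀ (p : ℕ) [Fact (Nat.Prime p)], p ∉ J → ∀ [Algebra (Localization S) ℤ_[p]],
      ∃ (s : ℕ) (e : Fin s → ℕ), (∀ i, 0 < e i) ∧
        IsGradedPolynomialOfType ℤ_[p] (ℤ_[p] ⊗[Localization S] A)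
          (fun n => (𝒜 n).baseChange ℤ_[p]) e) :
    IsGradedPolynomialOfType (Localization S) A 𝒜 d := by
  have hunit : ∀ {B : Type} [CommRing B] (f : ℤ →+* B), (∀ p ∈ J, IsUnit (f p)) →
      ∀ s : S, IsUnit (f s) := by
    intro B _ f hf s
    have : S ≤ (IsUnit.submonoid B).comap f := by
      rw [hS, Submonoid.closure_le]
      rintro _ ⟨p, hp, rfl⟩
      exact hf p hp
    exact this s.2
  have hS0 : S ≤ nonZeroDivisors ℤ := fun s hs => by
    have := hunit (Int.castRingHom ℚ)
      (fun p hp => by simpa using (hJ p hp).ne_zero) ⟨s, hs⟩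
    exact mem_nonZeroDivisors_of_ne_zero fun h => by simp [h] at this
  have : IsDomain (Localization S) := IsLocalization.isDomain_localization hS0
  have : IsPrincipalIdealRing (Localization S) :=
    IsLocalization.isPrincipalIdealRing (R := ℤ) _ S
  have (n : ℕ) : Module.Finite (Localization S) (𝒜 n) := (hfree n).2
  let : Algebra (Localization S) ℚ := (IsLocalization.lift (M := S) (g := Int.castRingHom ℚ)
    (hunit _ fun p hp => by simpa using (hJ p hp).ne_zero)).toAlgebra
  have := IsScalarTower.of_algebraMap_eq' (R := ℤ) (S := Localization S) (A := ℚ)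
    (Subsingleton.elim _ _)
  have : IsFractionRing (Localization S) ℚ :=
    IsFractionRing.isFractionRing_of_isDomain_of_isLocalization S _ _
  have hfrac : ∀ c : Localization S, ∃ (m : ℤ) (t : Localization S), IsUnit t ∧ c * t = m := by
    intro c
    obtain ⟨⟨m, t⟩, hmt⟩ := IsLocalization.surj S c
    exact ⟨m, _, IsLocalization.map_units (Localization S) t, by simpa using hmt⟩
  have hprime : ∀ n, 0 < n → ∀ a ∈ 𝒜 n, ∀ p : ℕ, p.Prime →
      (p : Localization S) • a ∈ decomposables 𝒜 n → a ∈ decomposables 𝒜 n := by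
    intro n hn a ha p hp hpa
    by_cases hpJ : p ∈ J
    · have hu : IsUnit (algebraMap ℤ (Localization S) p) :=
        IsLocalization.map_units (Localization S)
          (⟨p, hS ▸ Submonoid.subset_closure ⟨p, hpJ, rfl⟩⟩ : S)
      rw [map_natCast] at hu
      exact (Submodule.smul_mem_iff_of_isUnit _ hu).1 hpa
    · have : Fact p.Prime := ⟨hp⟩
      let : Algebra (Localization S) ℤ_[p] := (IsLocalization.lift (M := S)
        (g := Int.castRingHom ℤ_[p]) (hunit _ fun q hq => by
          have hpq : ¬ p ∣ q :=
            fun h => hpJ (((Nat.prime_dvd_prime_iff_eq hp (hJ q hq)).1 h) ▸ hq)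
          rw [eq_intCast, PadicInt.isUnit_intCast_iff]
          exact_mod_cast hpq)).toAlgebra
      have : Module.IsTorsionFree (Localization S) ℤ_[p] := by
        rw [Module.isTorsionFree_iff_algebraMap_injective, injective_iff_map_eq_zero]
        intro c hc
        obtain ⟨m, t, ht, hmt⟩ := hfrac c
        have hm := congrArg (algebraMap (Localization S) ℤ_[p]) hmt
        rw [map_mul, hc, zero_mul, map_intCast, eq_comm, Int.cast_eq_zero] at hm
        rw [hm, Int.cast_zero] at hmt
        exact ht.mul_left_eq_zero.1 hmt
      obtain ⟨s, e, he, hpoly⟩ := hZp p hpJ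
      have h1 : (1 : ℤ_[p]) ⊗ₜ[Localization S] a ∈ (decomposables 𝒜 n).baseChange ℤ_[p] := by
        rw [decomposables_baseChange]
        refine hpoly.mem_decomposables_of_smul_mem he hn
          (Submodule.tmul_mem_baseChange_of_mem _ ha) (c := (p : ℤ_[p]))
          (by exact_mod_cast hp.ne_zero) ?_
        rw [← decomposables_baseChange, ← map_natCast (algebraMap (Localization S) ℤ_[p]) p,
          algebraMap_smul, ← TensorProduct.tmul_smul]
        exact Submodule.tmul_mem_baseChange_of_mem _ hpa
      obtain ⟨c, hcu, hc⟩ := exists_isUnit_smul_mem_of_one_tmul_mem_baseChange h1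
      obtain ⟨m, t, ht, hmt⟩ := hfrac c
      have hm : (m : Localization S) • a ∈ decomposables 𝒜 n := by
        rw [← hmt, mul_comm, mul_smul]
        exact Submodule.smul_mem _ _ hc
      have hmp : IsUnit (m : ℤ_[p]) := by
        rw [← map_intCast (algebraMap (Localization S) ℤ_[p]), ← hmt, map_mul]
        exact hcu.mul (ht.map _)
      obtain ⟨u, v, huv⟩ := (Nat.prime_iff_prime_int.1 hp).coprime_iff_not_dvd.2
        (PadicInt.isUnit_intCast_iff.1 hmp)
      rw [← one_smul (Localization S) a, ← Int.cast_one, ← huv, Int.cast_add, Int.cast_mul,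
        Int.cast_mul, Int.cast_natCast, add_smul, mul_smul, mul_smul]
      exact add_mem (Submodule.smul_mem _ _ hpa) (Submodule.smul_mem _ _ hm)
  have hnat : ∀ n, 0 < n → ∀ m : ℕ, m ≠ 0 → ∀ a ∈ 𝒜 n,
      (m : Localization S) • a ∈ decomposables 𝒜 n → a ∈ decomposables 𝒜 n := by
    intro n hn m
    induction m using Nat.recOnMul with
    | zero => exact fun h => absurd rfl h
    | one => intro _ a _ h; simpa using h
    | prime p hp => exact fun _ a ha => hprime n hn a ha p hp
    | mul k l hk hl =>
      intro h a ha hkl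
      rw [mul_ne_zero_iff] at h
      rw [Nat.cast_mul, mul_smul] at hkl
      exact hl h.2 a ha (hk h.1 _ (Submodule.smul_mem _ _ ha) hkl)
  refine IsGradedPolynomialOfType.of_saturated 𝒜 hconn.2.le d hd (K := ℚ) hQ ?_
  intro n hn a ha c hc hca
  obtain ⟨m, t, ht, hmt⟩ := hfrac c
  have hm0 : m ≠ 0 := by
    rintro rfl
    rw [Int.cast_zero] at hmt
    exact hc (ht.mul_left_eq_zero.1 hmt)
  have hm : (m : Localization S) • a ∈ decomposables 𝒜 n := by
    rw [← hmt, mul_comm, mul_smul]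
    exact Submodule.smul_mem _ _ hca
  refine hnat n hn m.natAbs (Int.natAbs_ne_zero.2 hm0) a ha ?_
  rw [← Int.cast_natCast]
  rcases Int.natAbs_eq m with h | h
  · rwa [← h]
  · rw [← neg_neg (m.natAbs : ℤ), ← h, Int.cast_neg, neg_smul]
    exact neg_mem hm
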